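/- Fix t ∈ ℕ and suppose m/n^t ≪ s ≪ m/n^{t-1} where m = C(n, floor(n/2)) (i.e., s·n^t/m → ∞ and s·n^{t-1}/m → 0 as n → ∞). Then the number of antichains of size s in P(n) is C((t+o(1))·m, s), i.e., for every ε > 0 and all large n the count lies between C((t-ε)m, s) and C((t+ε)m, s). -/

import Mathlib

open scoped Classical

/-- The number of antichains of size `s` in the power set of `[n]`. -/
noncomputable def antichainCount (n s : ℕ) : ℕ :=
  (Finset.univ.filter (fun 𝒜 : Finset (Finset (Fin n)) =>
    𝒜.card = s ∧ IsAntichain (· ⊆ ·) (𝒜 : Set (Finset (Fin n))))).card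

section IndependentSets

variable {α : Type*} (r : α → α → Prop)

/-- The antichains of size `s` with respect to `r` contained in `A`. -/
noncomputable def antichainsIn (A : Finset α) (s : ℕ) : Finset (Finset α) :=
  (A.powersetCard s).filter fun S => IsAntichain r (S : Set α)

/-- The elements of `A` that are equal or related to `v`. -/
noncomputable def relatedIn (A : Finset α) (v : α) : Finset α :=
  A.filter fun u => u = v ∨ r u v ∨ r v u

variable {r}

lemma mem_antichainsIn {A S : Finset α} {s : ℕ} :
    S ∈ antichainsIn r A s ↔ (S ⊆ A ∧ S.card = s) ∧ IsAntichain r (S : Set α) := by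
  simp [antichainsIn, Finset.mem_powersetCard]

lemma mem_relatedIn {A : Finset α} {u v : α} :
    u ∈ relatedIn r A v ↔ u ∈ A ∧ (u = v ∨ r u v ∨ r v u) :=
  Finset.mem_filter

lemma relatedIn_subset (A : Finset α) (v : α) : relatedIn r A v ⊆ A :=
  Finset.filter_subset _ _

lemma relatedIn_mono {A B : Finset α} (h : A ⊆ B) (v : α) : relatedIn r A v ⊆ relatedIn r B v :=
  Finset.filter_subset_filter _ h

lemma card_antichainsIn_le_choose (A : Finset α) (s : ℕ) :
    (antichainsIn r A s).card ≤ A.card.choose s :=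
  (Finset.card_filter_le _ _).trans (Finset.card_powersetCard s A).le

lemma card_antichainsIn_zero (A : Finset α) : (antichainsIn r A 0).card = 1 := by
  simp [antichainsIn, Finset.filter_singleton]

variable [DecidableEq α]

lemma card_antichainsIn_succ_le (A : Finset α) (v : α) (s : ℕ) :
    (antichainsIn r A (s + 1)).card ≤
      (antichainsIn r (A.erase v) (s + 1)).card +
        (antichainsIn r (A \ relatedIn r A v) s).card := by
  rw [← Finset.card_filter_add_card_filter_not (s := antichainsIn r A (s + 1)) (fun S => v ∉ S)]
  refine add_le_add (Finset.card_le_card fun S hS => ?_) ?_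
  · simp only [Finset.mem_filter, mem_antichainsIn] at hS ⊢
    exact ⟨⟨Finset.subset_erase.2 ⟨hS.1.1.1, hS.2⟩, hS.1.1.2⟩, hS.1.2⟩
  · refine Finset.card_le_card_of_injOn (fun S => S.erase v) (fun S hS => ?_) ?_
    · simp only [Finset.coe_filter, Set.mem_ofPred_eq, mem_antichainsIn, not_not] at hS
      obtain ⟨⟨⟨hSA, hcard⟩, hanti⟩, hv⟩ := hS
      simp only [Finset.mem_coe, mem_antichainsIn]
      refine ⟨⟨fun u hu => ?_, by rw [Finset.card_erase_of_mem hv, hcard]; rfl⟩,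
        hanti.subset (by simp)⟩
      obtain ⟨huv, hu⟩ := Finset.mem_erase.1 hu
      simp only [mem_relatedIn, Finset.mem_sdiff, not_and, not_or]
      exact ⟨hSA hu, fun _ => ⟨huv, hanti hu hv huv, hanti hv hu (Ne.symm huv)⟩⟩
    · intro S hS T hT h
      simp only [Finset.coe_filter, Set.mem_ofPred_eq, not_not] at hS hT
      rw [← Finset.insert_erase hS.2, ← Finset.insert_erase hT.2]
      simp only at h
      rw [h]

/-- A Kleitman–Winston type bound: if every large subset of the ground set has an element
related to more than `D` others, then few antichains are not accounted for by small subsets. -/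
lemma card_antichainsIn_le_pow_mul {R D S : ℕ} {g : ℕ → ℝ} {ρ y : ℝ} (hy : 0 ≤ y)
    (hg : ∀ s, 0 ≤ g s)
    (hdeg : ∀ A : Finset α, R < A.card → ∃ v ∈ A, D < (relatedIn r A v).card)
    (hbase : ∀ A : Finset α, A.card ≤ R → ∀ s ≤ S, ((antichainsIn r A s).card : ℝ) ≤ g s)
    (hratio : ∀ s < S, g s ≤ ρ * g (s + 1)) (hρ : ρ ≤ y * (1 + y) ^ D) (A : Finset α) :
    ∀ s ≤ S, ((antichainsIn r A s).card : ℝ) ≤ (1 + y) ^ A.card * g s := by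
  have hx : 1 ≤ 1 + y := by linarith
  induction A using Finset.strongInduction with
  | H A ih =>
  intro s hs
  by_cases hA : A.card ≤ R
  · exact (hbase A hA s hs).trans (le_mul_of_one_le_left (hg s) (one_le_pow₀ hx))
  obtain ⟨v, hv, hD⟩ := hdeg A (not_le.1 hA)
  rcases s with _ | s
  · have h := hbase ∅ (by simp) 0 hs
    simp only [card_antichainsIn_zero] at h ⊢
    exact h.trans (le_mul_of_one_le_left (hg 0) (one_le_pow₀ hx))
  have hsub : relatedIn r A v ⊆ A := relatedIn_subset A v
  have hvr : v ∈ relatedIn r A v := by simp [mem_relatedIn, hv]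
  have h1 := ih (A.erase v) (Finset.erase_ssubset hv) (s + 1) hs
  have h2 := ih (A \ relatedIn r A v) (Finset.sdiff_ssubset hsub ⟨v, hvr⟩) s (by omega)
  have hle := Finset.card_le_card hsub
  rw [Finset.card_erase_of_mem hv] at h1
  rw [Finset.card_sdiff_of_subset hsub] at h2
  obtain ⟨k, hk⟩ : ∃ k, A.card = k + D + 1 := ⟨A.card - D - 1, by omega⟩
  have h3 : (1 + y) ^ (A.card - (relatedIn r A v).card) ≤ (1 + y) ^ k :=
    pow_le_pow_right₀ hx (by omega)
  have h4 : ((antichainsIn r (A \ relatedIn r A v) s).card : ℝ) ≤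
      (1 + y) ^ k * ((y * (1 + y) ^ D) * g (s + 1)) := by
    refine h2.trans (mul_le_mul h3 ?_ (hg s) (by positivity))
    exact (hratio s (by omega)).trans (mul_le_mul_of_nonneg_right hρ (hg _))
  have h5 : ((antichainsIn r A (s + 1)).card : ℝ) ≤
      (antichainsIn r (A.erase v) (s + 1)).card +
        (antichainsIn r (A \ relatedIn r A v) s).card := by
    exact_mod_cast card_antichainsIn_succ_le A v s
  have h6 : A.card - 1 = k + D := by omega
  rw [h6] at h1
  rw [hk]
  calc ((antichainsIn r A (s + 1)).card : ℝ)
      ≤ (1 + y) ^ (k + D) * g (s + 1) + (1 + y) ^ k * ((y * (1 + y) ^ D) * g (s + 1)) := by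
        linarith
    _ = (1 + y) ^ (k + D + 1) * g (s + 1) := by ring

/-- Greedy extension: an antichain of size `s` extends in many ways if all elements are
related to few others. -/
lemma card_antichainsIn_mul_le {A : Finset α} {Δ : ℕ}
    (hΔ : ∀ v ∈ A, (relatedIn r A v).card ≤ Δ) (s : ℕ) :
    (antichainsIn r A s).card * (A.card - s * Δ) ≤ (antichainsIn r A (s + 1)).card * (s + 1) := by
  refine Finset.card_mul_le_card_mul (fun S T => S ⊆ T) (fun S hS => ?_) (fun T hT => ?_)
  · obtain ⟨⟨hSA, hcard⟩, hanti⟩ := mem_antichainsIn.1 hS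
    have hunion : (S.biUnion (relatedIn r A)).card ≤ s * Δ := by
      rw [← hcard]
      exact Finset.card_biUnion_le_card_mul _ _ _ fun v hv => hΔ v (hSA hv)
    calc A.card - s * Δ ≤ (A \ S.biUnion (relatedIn r A)).card := by
          have := Finset.le_card_sdiff (S.biUnion (relatedIn r A)) A
          omega
      _ ≤ _ := by
          have hnot : ∀ v ∈ A \ S.biUnion (relatedIn r A),
              v ∈ A ∧ v ∉ S ∧ ∀ u ∈ S, ¬ r u v ∧ ¬ r v u := by
            intro v hv
            simp only [Finset.mem_sdiff, Finset.mem_biUnion, mem_relatedIn,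
              not_exists, not_and, not_or] at hv
            exact ⟨hv.1, fun h => (hv.2 v h hv.1).1 rfl,
              fun u hu => ⟨(hv.2 u hu hv.1).2.2, (hv.2 u hu hv.1).2.1⟩⟩
          refine Finset.card_le_card_of_injOn (fun v => insert v S) (fun v hv => ?_) ?_
          · obtain ⟨hvA, hvS, hr⟩ := hnot v hv
            simp only [Finset.mem_coe, Finset.mem_bipartiteAbove, mem_antichainsIn,
              Finset.subset_insert, and_true]
            refine ⟨⟨Finset.insert_subset hvA hSA, by
              rw [Finset.card_insert_of_notMem hvS, hcard]⟩, ?_⟩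
            rw [Finset.coe_insert]
            exact hanti.insert (fun u hu _ => (hr u hu).1) (fun u hu _ => (hr u hu).2)
          · intro v hv w hw h
            have hvS := (hnot v hv).2.1
            have : v ∈ insert w S := by
              simp only at h
              rw [← h]; exact Finset.mem_insert_self _ _
            exact (Finset.mem_insert.1 this).resolve_right hvS
  · obtain ⟨⟨-, hcard⟩, -⟩ := mem_antichainsIn.1 hT
    calc _ ≤ (T.powersetCard s).card := by
          refine Finset.card_le_card fun S hS => ?_
          obtain ⟨hS, hST⟩ := (Finset.mem_bipartiteBelow _).1 hS
          exact Finset.mem_powersetCard.2 ⟨hST, (mem_antichainsIn.1 hS).1.2⟩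
      _ = s + 1 := by rw [Finset.card_powersetCard, hcard, Nat.choose_succ_self_right]

lemma pow_le_factorial_mul_card_antichainsIn {A : Finset α} {Δ : ℕ}
    (hΔ : ∀ v ∈ A, (relatedIn r A v).card ≤ Δ) (S : ℕ) :
    ∀ s ≤ S, (A.card - S * Δ) ^ s ≤ s.factorial * (antichainsIn r A s).card := by
  intro s
  induction s with
  | zero => simp [card_antichainsIn_zero]
  | succ s ih =>
    intro hs
    have h1 := ih (by omega)
    have h2 := card_antichainsIn_mul_le hΔ s
    have h3 : A.card - S * Δ ≤ A.card - s * Δ :=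
      Nat.sub_le_sub_left (Nat.mul_le_mul_right _ (by omega)) _
    calc (A.card - S * Δ) ^ (s + 1)
        ≤ (s.factorial * (antichainsIn r A s).card) * (A.card - s * Δ) := by
          rw [pow_succ]; exact Nat.mul_le_mul h1 h3
      _ = s.factorial * ((antichainsIn r A s).card * (A.card - s * Δ)) := by ring
      _ ≤ s.factorial * ((antichainsIn r A (s + 1)).card * (s + 1)) := Nat.mul_le_mul_left _ h2
      _ = (s + 1).factorial * (antichainsIn r A (s + 1)).card := by
          rw [Nat.factorial_succ]; ring

lemma choose_le_card_antichainsIn {A : Finset α} {Δ s M : ℕ}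
    (hΔ : ∀ v ∈ A, (relatedIn r A v).card ≤ Δ) (hM : M ≤ A.card - s * Δ) :
    M.choose s ≤ (antichainsIn r A s).card := by
  refine Nat.le_of_mul_le_mul_left ?_ s.factorial_pos
  rw [← Nat.descFactorial_eq_factorial_mul_choose]
  exact (Nat.descFactorial_le_pow M s).trans ((Nat.pow_le_pow_left hM s).trans
    (pow_le_factorial_mul_card_antichainsIn hΔ s s le_rfl))

end IndependentSets

section Numberings

open Numbering

variable {X : Type*} [Fintype X]

lemma Numbering.IsPrefix.eq_of_card_eq {f : Numbering X} {A B : Finset X} (hA : IsPrefix f A)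
    (hB : IsPrefix f B) (h : A.card = B.card) : A = B := by
  ext x
  rw [hA x, hB x, h]

variable [DecidableEq X]

lemma card_prefixed_inter_prefixed_le {A B : Finset X} (hAB : A ⊆ B) :
    (prefixed A ∩ prefixed B).card ≤
      A.card.factorial * (B.card - A.card).factorial *
        (Fintype.card X - B.card).factorial := by
  let A' : Finset B := A.subtype (· ∈ B)
  have hA' : A'.card = A.card := by
    rw [Finset.card_subtype, Finset.filter_true_of_mem fun x hx => hAB hx]
  have h : (prefixed A ∩ prefixed B).card ≤
      ((prefixed A') ×ˢ (Finset.univ : Finset (Numbering ↑(Bᶜ)))).card := by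
    refine Finset.card_le_card_of_injOn
      (fun f => if hf : f ∈ prefixed B then prefixedEquiv B ⟨f, hf⟩ else
        (Fintype.equivFin _, Fintype.equivFin _)) (fun f hf => ?_) ?_
    · obtain ⟨hfA, hfB⟩ := Finset.mem_inter.1 hf
      simp only [hfB, dif_pos, Finset.coe_product, Set.mem_prod, Finset.mem_coe, mem_prefixed,
        Finset.mem_univ, and_true]
      intro x
      rw [hA', Finset.mem_subtype, mem_prefixed.1 hfA x]
      rfl
    · intro f hf g hg h
      have hfB := (Finset.mem_inter.1 hf).2
      have hgB := (Finset.mem_inter.1 hg).2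
      simp only [hfB, hgB, dif_pos] at h
      exact congrArg Subtype.val ((prefixedEquiv B).injective h)
  refine h.trans (le_of_eq ?_)
  rw [Finset.card_product, card_prefixed, hA', Finset.card_univ, Fintype.card_numbering]
  simp

/-- A numbering with more than `T` prefixes in `F` has as many pairs of prefixes whose sizes
differ by at least `T`. -/
lemma card_filter_isPrefix_le (F : Finset (Finset X)) (f : Numbering X) (T : ℕ) :
    (F.filter (IsPrefix f)).card ≤ T +
      (((F ×ˢ F).filter fun p => p.1 ⊆ p.2 ∧ p.1.card + T ≤ p.2.card).filter fun p =>
        IsPrefix f p.1 ∧ IsPrefix f p.2).card := by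
  set C := F.filter (IsPrefix f) with hC
  rw [← Finset.card_filter_add_card_filter_not (s := C)
    (fun B => ∀ A ∈ C, B.card < A.card + T)]
  refine add_le_add ?_ ?_
  · rcases C.eq_empty_or_nonempty with h | h
    · simp [h]
    obtain ⟨M, hM, hmin⟩ := C.exists_min_image Finset.card h
    calc _ ≤ (Finset.Ico M.card (M.card + T)).card := by
          refine Finset.card_le_card_of_injOn Finset.card (fun B hB => ?_) ?_
          · simp only [Finset.coe_filter, Set.mem_ofPred_eq] at hB
            simp only [Finset.coe_Ico, Set.mem_Ico]
            exact ⟨hmin B hB.1, hB.2 M hM⟩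
          · intro A hA B hB h
            simp only [Finset.coe_filter, Set.mem_ofPred_eq, hC, Finset.mem_filter] at hA hB
            exact hA.1.2.eq_of_card_eq hB.1.2 h
      _ = T := by simp
  · refine Finset.card_le_card_of_surjOn Prod.snd fun B hB => ?_
    simp only [Finset.coe_filter, Set.mem_ofPred_eq, not_forall, not_lt] at hB
    obtain ⟨hB, A, hA, hAB⟩ := hB
    rw [hC, Finset.mem_filter] at hA hB
    refine ⟨(A, B), ?_, rfl⟩
    simp only [Finset.coe_filter, Set.mem_ofPred_eq, Finset.mem_filter, Finset.mem_product]
    exact ⟨⟨⟨hA.1, hB.1⟩, hA.2.subset_of_card_le_card hB.2 (by omega), hAB⟩, hA.2, hB.2⟩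

/-- Averaging over all maximal chains. -/
lemma sum_factorial_le (F : Finset (Finset X)) (T : ℕ) :
    ∑ A ∈ F, A.card.factorial * (Fintype.card X - A.card).factorial ≤
      T * (Fintype.card X).factorial +
        ∑ p ∈ (F ×ˢ F).filter (fun p => p.1 ⊆ p.2 ∧ p.1.card + T ≤ p.2.card),
          p.1.card.factorial * (p.2.card - p.1.card).factorial *
            (Fintype.card X - p.2.card).factorial := by
  have h := Finset.sum_le_sum fun (f : Numbering X) (_ : f ∈ Finset.univ) =>
    card_filter_isPrefix_le F f T
  rw [Finset.sum_add_distrib] at h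
  have h1 : ∑ f : Numbering X, (F.filter (IsPrefix f)).card =
      ∑ A ∈ F, A.card.factorial * (Fintype.card X - A.card).factorial := by
    simp_rw [Finset.card_filter]
    rw [Finset.sum_comm]
    refine Finset.sum_congr rfl fun A _ => ?_
    rw [← card_prefixed, prefixed, Finset.card_filter]
  have h2 : ∑ _f : Numbering X, T = T * (Fintype.card X).factorial := by
    simp [mul_comm]
  rw [h1, h2] at h
  refine h.trans (Nat.add_le_add_left ?_ _)
  simp_rw [Finset.card_filter (fun p : Finset X × Finset X => IsPrefix _ p.1 ∧ IsPrefix _ p.2)]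
  rw [Finset.sum_comm]
  refine Finset.sum_le_sum fun p hp => ?_
  refine le_trans (le_of_eq ?_) (card_prefixed_inter_prefixed_le (Finset.mem_filter.1 hp).2.1)
  rw [prefixed, prefixed, ← Finset.filter_and, Finset.card_filter]

end Numberings

section Supersaturation

lemma choose_half_le_choose {a b T : ℕ} (ha : T ≤ a) (hab : a + T ≤ b) :
    (b / 2).choose T ≤ b.choose a := by
  rcases le_total b (2 * a) with h | h
  · calc (b / 2).choose T ≤ (a + T).choose T := Nat.choose_le_choose _ (by omega)
      _ = (a + T).choose a := (Nat.choose_symm_add).symm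
      _ ≤ b.choose a := Nat.choose_le_choose _ hab
  · calc (b / 2).choose T ≤ (b - a + T).choose T := Nat.choose_le_choose _ (by omega)
      _ = (b - a + T).choose (b - a) := (Nat.choose_symm_add).symm
      _ ≤ b.choose (b - a) := Nat.choose_le_choose _ (by omega)
      _ = b.choose a := Nat.choose_symm (by omega)

lemma choose_mul_factorials_le {n a b T : ℕ} (ha : T ≤ a) (hab : a + T ≤ b) (hb : b + T ≤ n) :
    (n / 4).choose T * (a.factorial * (b - a).factorial * (n - b).factorial) ≤
      a.factorial * (n - a).factorial + b.factorial * (n - b).factorial := by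
  rcases le_total (n / 2) b with h | h
  · have h1 : (n / 4).choose T ≤ b.choose a :=
      (Nat.choose_le_choose _ (by omega)).trans (choose_half_le_choose ha hab)
    calc _ ≤ b.choose a * (a.factorial * (b - a).factorial * (n - b).factorial) :=
          Nat.mul_le_mul_right _ h1
      _ = b.choose a * a.factorial * (b - a).factorial * (n - b).factorial := by ring
      _ = b.factorial * (n - b).factorial := by
          rw [Nat.choose_mul_factorial_mul_factorial (by omega)]
      _ ≤ _ := Nat.le_add_left _ _
  · have h1 : (n / 4).choose T ≤ (n - a).choose (n - b) :=
      (Nat.choose_le_choose _ (by omega)).trans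
        (choose_half_le_choose (by omega : T ≤ n - b) (by omega))
    have h2 : b - a = (n - a) - (n - b) := by omega
    calc _ ≤ (n - a).choose (n - b) * (a.factorial * (b - a).factorial * (n - b).factorial) :=
          Nat.mul_le_mul_right _ h1
      _ = a.factorial * ((n - a).choose (n - b) * (n - b).factorial *
            ((n - a) - (n - b)).factorial) := by rw [h2]; ring
      _ = a.factorial * (n - a).factorial := by
          rw [Nat.choose_mul_factorial_mul_factorial (by omega)]
      _ ≤ _ := Nat.le_add_right _ _

lemma choose_mul_sum_factorial_le {n T D : ℕ} (hT : 1 ≤ T) (F : Finset (Finset (Fin n)))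
    (hF : ∀ A ∈ F, T ≤ A.card ∧ A.card + T ≤ n)
    (hD : ∀ A ∈ F, (relatedIn (· ⊆ ·) F A).card ≤ D + 1) :
    (n / 4).choose T * ∑ A ∈ F, A.card.factorial * (n - A.card).factorial ≤
      (n / 4).choose T * (T * n.factorial) +
        D * ∑ A ∈ F, A.card.factorial * (n - A.card).factorial := by
  have h := sum_factorial_le F T
  rw [Fintype.card_fin] at h
  refine (Nat.mul_le_mul_left _ h).trans ?_
  rw [mul_add]
  refine Nat.add_le_add_left ?_ _
  set w : Finset (Fin n) → ℕ := fun A => A.card.factorial * (n - A.card).factorial with hw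
  let P : Finset (Fin n) → Finset (Fin n) → Prop := fun A B => A ⊆ B ∧ A.card + T ≤ B.card
  calc _ ≤ ∑ p ∈ (F ×ˢ F).filter (fun p => P p.1 p.2), (w p.1 + w p.2) := by
        rw [Finset.mul_sum]
        refine Finset.sum_le_sum fun p hp => ?_
        obtain ⟨hp, -, hcard⟩ := Finset.mem_filter.1 hp
        obtain ⟨h1, h2⟩ := Finset.mem_product.1 hp
        exact choose_mul_factorials_le (hF _ h1).1 hcard (hF _ h2).2
    _ = ∑ A ∈ F, ∑ B ∈ F, ((if P A B then w A else 0) + (if P B A then w A else 0)) := by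
        simp_rw [Finset.sum_add_distrib]
        rw [Finset.sum_filter, Finset.sum_filter, Finset.sum_product, Finset.sum_product]
        congr 1
        rw [Finset.sum_comm]
    _ ≤ ∑ A ∈ F, D * w A := by
        refine Finset.sum_le_sum fun A hA => ?_
        have hmem : A ∈ relatedIn (· ⊆ ·) F A := by simp [mem_relatedIn, hA]
        calc _ ≤ ∑ B ∈ F, if B ∈ (relatedIn (· ⊆ ·) F A).erase A then w A else 0 := by
              refine Finset.sum_le_sum fun B hB => ?_
              by_cases h1 : P A B
              · have h2 : ¬ P B A := fun h2 => by have := h1.2; have := h2.2; omega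
                have h3 : B ∈ (relatedIn (· ⊆ ·) F A).erase A := by
                  refine Finset.mem_erase.2 ⟨?_, by simp [mem_relatedIn, hB, h1.1]⟩
                  rintro rfl
                  exact h2 h1
                simp [h1, h2, h3]
              · by_cases h2 : P B A
                · have h3 : B ∈ (relatedIn (· ⊆ ·) F A).erase A := by
                    refine Finset.mem_erase.2 ⟨?_, by simp [mem_relatedIn, hB, h2.1]⟩
                    rintro rfl
                    exact h1 h2
                  simp [h1, h2, h3]
                · simp [h1, h2]
          _ = ((relatedIn (· ⊆ ·) F A).erase A).card * w A := by
              rw [← Finset.sum_filter, Finset.sum_const, smul_eq_mul,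
                Finset.filter_mem_eq_inter, Finset.inter_eq_right.2]
              exact (Finset.erase_subset _ _).trans (relatedIn_subset _ _)
          _ ≤ D * w A := by
              refine Nat.mul_le_mul_right _ ?_
              rw [Finset.card_erase_of_mem hmem]
              have := hD A hA
              omega
    _ = D * ∑ A ∈ F, w A := by rw [Finset.mul_sum]

lemma exists_lt_card_relatedIn {n T D : ℕ} (hT : 1 ≤ T) {η : ℝ} (hη : 0 < η)
    (F : Finset (Finset (Fin n))) (hF : ∀ A ∈ F, T ≤ A.card ∧ A.card + T ≤ n)
    (hcard : ((T : ℝ) + η) * (n.choose (n / 2) : ℝ) ≤ F.card)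
    (hD : (D : ℝ) * (T + η) < (n / 4).choose T * η) :
    ∃ A ∈ F, D + 1 < (relatedIn (· ⊆ ·) F A).card := by
  by_contra! hcon
  have h := choose_mul_sum_factorial_le hT F hF hcon
  set W := ∑ A ∈ F, A.card.factorial * (n - A.card).factorial with hW
  have hm : (0 : ℝ) < n.choose (n / 2) := by
    exact_mod_cast Nat.choose_pos (Nat.div_le_self n 2)
  have h1 : F.card * n.factorial ≤ n.choose (n / 2) * W := by
    rw [hW, Finset.mul_sum, ← smul_eq_mul, ← Finset.sum_const]
    refine Finset.sum_le_sum fun A hA => ?_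
    have hAn : A.card ≤ n := by have := (hF A hA).2; omega
    rw [← Nat.choose_mul_factorial_mul_factorial hAn, mul_assoc]
    exact Nat.mul_le_mul_right _ (Nat.choose_le_middle _ _)
  have h1' : (F.card : ℝ) * n.factorial ≤ n.choose (n / 2) * W := by exact_mod_cast h1
  have hn : (0 : ℝ) < n.factorial := by exact_mod_cast n.factorial_pos
  have h2 : ((T : ℝ) + η) * n.factorial ≤ W := by
    refine le_of_mul_le_mul_left ?_ hm
    refine le_trans ?_ h1'
    have := mul_le_mul_of_nonneg_right hcard hn.le
    linarith
  have hT' : (0 : ℝ) < T + η := by positivity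
  have hWpos : (0 : ℝ) < W := lt_of_lt_of_le (by positivity) h2
  have h3 : ((n / 4).choose T : ℝ) * W ≤ (n / 4).choose T * (T * n.factorial) + D * W := by
    exact_mod_cast h
  have hK : (0 : ℝ) ≤ (n / 4).choose T := by positivity
  have h4 := mul_lt_mul_of_pos_right hD hWpos
  have h5 := mul_le_mul_of_nonneg_left h2 (mul_nonneg hK (Nat.cast_nonneg (α := ℝ) T))
  have h6 := mul_le_mul_of_nonneg_right h3 hT'.le
  nlinarith

lemma card_filter_card_lt_le {n : ℕ} (hn : 1 ≤ n) (T : ℕ) :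
    ((Finset.univ : Finset (Finset (Fin n))).filter fun X => X.card < T).card ≤
      T * n ^ (T - 1) := by
  calc _ ≤ ((Finset.range T).biUnion fun k =>
          Finset.powersetCard k (Finset.univ : Finset (Fin n))).card := by
        refine Finset.card_le_card fun X hX => ?_
        simp only [Finset.mem_filter, Finset.mem_univ, true_and] at hX
        simp [Finset.mem_powersetCard, hX]
    _ ≤ (Finset.range T).card * n ^ (T - 1) := by
        refine Finset.card_biUnion_le_card_mul _ _ _ fun k hk => ?_
        rw [Finset.card_powersetCard, Finset.card_univ, Fintype.card_fin]
        have := Finset.mem_range.1 hk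
        exact (Nat.choose_le_pow n k).trans (Nat.pow_le_pow_right hn (by omega))
    _ = _ := by rw [Finset.card_range]

lemma card_filter_not_central_le {n : ℕ} (hn : 1 ≤ n) (T : ℕ) :
    ((Finset.univ : Finset (Finset (Fin n))).filter fun X =>
      ¬ (T ≤ X.card ∧ X.card + T ≤ n)).card ≤ 2 * (T * n ^ (T - 1)) := by
  have h1 := card_filter_card_lt_le hn T
  have h2 : ((Finset.univ : Finset (Finset (Fin n))).filter fun X => n < X.card + T).card ≤
      ((Finset.univ : Finset (Finset (Fin n))).filter fun X => X.card < T).card := by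
    refine Finset.card_le_card_of_injOn (fun X => Xᶜ) (fun X hX => ?_)
      (compl_injective.injOn)
    simp only [Finset.coe_filter, Finset.mem_univ, true_and, Set.mem_ofPred_eq] at hX ⊢
    rw [Finset.card_compl, Fintype.card_fin]
    have : X.card ≤ n := by simpa using X.card_le_univ
    omega
  have h3 : ((Finset.univ : Finset (Finset (Fin n))).filter fun X =>
      ¬ (T ≤ X.card ∧ X.card + T ≤ n)) ⊆
      ((Finset.univ : Finset (Finset (Fin n))).filter fun X => X.card < T) ∪
      ((Finset.univ : Finset (Finset (Fin n))).filter fun X => n < X.card + T) := by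
    intro X hX
    simp only [Finset.mem_filter, Finset.mem_univ, true_and, Finset.mem_union] at hX ⊢
    omega
  have := (Finset.card_le_card h3).trans (Finset.card_union_le _ _)
  omega

lemma two_pow_le_mul_choose_half (n : ℕ) : 2 ^ n ≤ (n + 1) * n.choose (n / 2) := by
  rw [← Nat.sum_range_choose]
  calc _ ≤ ∑ _k ∈ Finset.range (n + 1), n.choose (n / 2) :=
        Finset.sum_le_sum fun k _ => Nat.choose_le_middle k n
    _ = _ := by simp

lemma eventually_pow_le_mul_choose_half (T : ℕ) {C η : ℝ} (hC : 0 < C) (hη : 0 < η) :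
    ∀ᶠ n : ℕ in Filter.atTop, C * (n : ℝ) ^ T ≤ η * n.choose (n / 2) := by
  have h := tendsto_pow_const_div_const_pow_of_one_lt (T + 1) (one_lt_two (α := ℝ))
  have hpos : 0 < η / (2 * C) := by positivity
  filter_upwards [h.eventually_le_const hpos, Filter.eventually_ge_atTop 1] with n hn hn1
  rw [div_le_div_iff₀ (by positivity) (by positivity)] at hn
  have h1 : ((2 : ℝ)) ^ n ≤ (n + 1) * n.choose (n / 2) := by
    exact_mod_cast two_pow_le_mul_choose_half n
  have hn1' : (1 : ℝ) ≤ n := by exact_mod_cast hn1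
  have hn0 : (0 : ℝ) < n := by linarith
  have hm : (0 : ℝ) ≤ n.choose (n / 2) := by positivity
  have h2 : (2 : ℝ) ^ n ≤ 2 * n * n.choose (n / 2) := by nlinarith
  have h3 := mul_le_mul_of_nonneg_left h2 hη.le
  refine le_of_mul_le_mul_left ?_ (by positivity : (0 : ℝ) < 2 * n)
  rw [pow_succ] at hn
  linarith

lemma mul_pow_le_choose_div_four {n T : ℕ} (hn : 8 * T ≤ n) :
    1 / ((8 : ℝ) ^ T * T.factorial) * (n : ℝ) ^ T ≤ (n / 4).choose T := by
  refine le_trans ?_ (Nat.pow_le_choose (α := ℝ) T (n / 4))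
  have h1 : (n : ℝ) / 8 ≤ ((n / 4 + 1 - T : ℕ) : ℝ) := by
    rw [div_le_iff₀ (by norm_num)]
    have : n ≤ (n / 4 + 1 - T) * 8 := by omega
    exact_mod_cast this
  calc _ = ((n : ℝ) / 8) ^ T / T.factorial := by rw [div_pow]; field_simp
    _ ≤ _ := by gcongr

/-- Supersaturation: a family noticeably larger than `T` middle layers has a member
comparable to order `n ^ T` other members. -/
lemma exists_eventually_exists_lt_card_relatedIn {T : ℕ} (hT : 1 ≤ T) {η : ℝ} (hη : 0 < η) :
    ∃ δ : ℝ, 0 < δ ∧ ∀ᶠ n : ℕ in Filter.atTop, ∃ D : ℕ, δ * (n : ℝ) ^ T ≤ D ∧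
      ∀ A : Finset (Finset (Fin n)), ((T : ℝ) + η) * (n.choose (n / 2) : ℝ) ≤ A.card →
        ∃ v ∈ A, D < (relatedIn (· ⊆ ·) A v).card := by
  set κ : ℝ := 1 / ((8 : ℝ) ^ T * T.factorial) with hκ
  have hκpos : 0 < κ := by positivity
  have hTη : (0 : ℝ) < T + η / 2 := by positivity
  have hT0 : (0 : ℝ) < T := by exact_mod_cast hT
  refine ⟨κ * (η / 2) / (2 * (T + η / 2)), by positivity, ?_⟩
  filter_upwards [Filter.eventually_ge_atTop (8 * T),
    eventually_pow_le_mul_choose_half (T - 1) (C := 2 * T) (by positivity)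
      (half_pos hη)] with n hn hout
  have hn1 : 1 ≤ n := by omega
  have hn0 : (0 : ℝ) < n := by exact_mod_cast hn1
  set x : ℝ := κ * (η / 2) / (2 * (T + η / 2)) * (n : ℝ) ^ T with hx
  refine ⟨⌊x⌋₊ + 1, by exact_mod_cast (Nat.lt_floor_add_one x).le, fun A hA => ?_⟩
  set F := A.filter fun X => T ≤ X.card ∧ X.card + T ≤ n with hF
  have hAF : A.card ≤ F.card + 2 * (T * n ^ (T - 1)) := by
    rw [← Finset.card_filter_add_card_filter_not (s := A)
      (fun X => T ≤ X.card ∧ X.card + T ≤ n)]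
    refine Nat.add_le_add_left ?_ _
    refine le_trans (Finset.card_le_card ?_) (card_filter_not_central_le hn1 T)
    exact Finset.filter_subset_filter _ (Finset.subset_univ _)
  have hAF' : (A.card : ℝ) ≤ F.card + 2 * (T * (n : ℝ) ^ (T - 1)) := by exact_mod_cast hAF
  obtain ⟨v, hv, hlt⟩ := exists_lt_card_relatedIn (D := ⌊x⌋₊) hT (half_pos hη) F
    (fun X hX => (Finset.mem_filter.1 hX).2) (by linarith) (by
      have h1 : (⌊x⌋₊ : ℝ) ≤ x := Nat.floor_le (by positivity)
      have h2 := mul_pow_le_choose_div_four hn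
      rw [← hκ] at h2
      calc (⌊x⌋₊ : ℝ) * (T + η / 2) ≤ x * (T + η / 2) := by gcongr
        _ = (κ * (n : ℝ) ^ T) * (η / 2) / 2 := by rw [hx]; field_simp
        _ < (κ * (n : ℝ) ^ T) * (η / 2) := half_lt_self (by positivity)
        _ ≤ _ := by gcongr)
  refine ⟨v, (Finset.mem_filter.1 hv).1, hlt.trans_le (Finset.card_le_card ?_)⟩
  exact relatedIn_mono (Finset.filter_subset _ _) v

end Supersaturation

section MiddleLayers

lemma eventually_le_choose_half_add (j : ℕ) : ∀ η : ℝ, 0 < η → ∀ᶠ n : ℕ in Filter.atTop,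
    (1 - η) * (n.choose (n / 2) : ℝ) ≤ n.choose (n / 2 + j) := by
  induction j with
  | zero =>
    intro η hη
    refine Filter.Eventually.of_forall fun n => ?_
    have : (0 : ℝ) ≤ n.choose (n / 2) := by positivity
    rw [add_zero]
    nlinarith
  | succ j ih =>
    intro η hη
    rcases le_total 1 η with h1 | h1
    · refine Filter.Eventually.of_forall fun n => ?_
      refine le_trans (mul_nonpos_of_nonpos_of_nonneg (by linarith) ?_) ?_ <;> positivity
    obtain ⟨N, hN⟩ := exists_nat_ge ((2 * j + 1) / (η / 2))
    filter_upwards [ih (η / 2) (half_pos hη), Filter.eventually_ge_atTop (2 * N + 2 * j)]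
      with n hn hnN
    set k := n / 2 + j with hk
    have hkn : k ≤ n := by omega
    have hNk : N ≤ k + 1 := by omega
    have hrec : (n.choose (k + 1) : ℝ) * (k + 1) = n.choose k * (n - k) := by
      have := Nat.choose_succ_right_eq n k
      rw [← Nat.cast_sub hkn]
      exact_mod_cast this
    have hgap : (k : ℝ) + 1 ≤ (n - k) + (2 * j + 1) := by
      have : k + 1 + k ≤ n + (2 * j + 1) := by omega
      have : ((k : ℝ) + 1 + k) ≤ n + (2 * j + 1) := by exact_mod_cast this
      linarith
    have hj : (2 * (j : ℝ) + 1) ≤ η / 2 * (k + 1) := by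
      rw [div_le_iff₀ (half_pos hη)] at hN
      have : (N : ℝ) ≤ k + 1 := by exact_mod_cast hNk
      nlinarith
    have hm : (0 : ℝ) ≤ n.choose (n / 2) := by positivity
    have hc : (0 : ℝ) ≤ n.choose k := by positivity
    have hk0 : (0 : ℝ) < k + 1 := by positivity
    refine le_of_mul_le_mul_right ?_ hk0
    rw [← add_assoc, ← hk, hrec]
    calc (1 - η) * (n.choose (n / 2) : ℝ) * (k + 1)
        ≤ ((1 - η / 2) * n.choose (n / 2)) * ((1 - η / 2) * (k + 1)) := by
          have : 0 ≤ (η / 2) ^ 2 * ((n.choose (n / 2) : ℝ) * (k + 1)) := by positivity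
          nlinarith
      _ ≤ n.choose k * (n - k) :=
          mul_le_mul hn (by linarith) (mul_nonneg (by linarith) hk0.le) hc

/-- The `t` layers of `P(n)` starting from the middle one. -/
noncomputable def middleLayers (n t : ℕ) : Finset (Finset (Fin n)) :=
  (Finset.range t).biUnion fun j => Finset.powersetCard (n / 2 + j) Finset.univ

lemma card_middleLayers (n t : ℕ) :
    (middleLayers n t).card = ∑ j ∈ Finset.range t, n.choose (n / 2 + j) := by
  rw [middleLayers, Finset.card_biUnion]
  · simp
  · intro i _ j _ hij
    exact Finset.pairwise_disjoint_powersetCard _ (by simpa using hij)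

lemma eventually_le_card_middleLayers {t : ℕ} (ht : 1 ≤ t) {ε : ℝ} (hε : 0 < ε) :
    ∀ᶠ n : ℕ in Filter.atTop,
      ((t : ℝ) - ε) * (n.choose (n / 2) : ℝ) ≤ (middleLayers n t).card := by
  have ht0 : (0 : ℝ) < t := by exact_mod_cast ht
  have h : ∀ᶠ n : ℕ in Filter.atTop, ∀ j ∈ Finset.range t,
      (1 - ε / t) * (n.choose (n / 2) : ℝ) ≤ n.choose (n / 2 + j) :=
    (Filter.eventually_all_finset _).2 fun j _ =>
      eventually_le_choose_half_add j _ (by positivity)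
  filter_upwards [h] with n hn
  rw [card_middleLayers, Nat.cast_sum]
  refine le_trans (le_of_eq ?_) (Finset.sum_le_sum hn)
  rw [Finset.sum_const, Finset.card_range, nsmul_eq_mul]
  field_simp

lemma card_relatedIn_middleLayers_le {n : ℕ} (hn : 1 ≤ n) (t : ℕ) {v : Finset (Fin n)}
    (hv : v ∈ middleLayers n t) :
    (relatedIn (· ⊆ ·) (middleLayers n t) v).card ≤ t * n ^ (t - 1) := by
  have hmem : ∀ u ∈ middleLayers n t, n / 2 ≤ u.card ∧ u.card < n / 2 + t := by
    intro u hu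
    simp only [middleLayers, Finset.mem_biUnion, Finset.mem_range,
      Finset.mem_powersetCard_univ] at hu
    obtain ⟨j, hj, hu⟩ := hu
    omega
  refine le_trans ?_ (card_filter_card_lt_le hn t)
  refine Finset.card_le_card_of_injOn (fun u => symmDiff u v) (fun u hu => ?_)
    (symmDiff_left_injective v).injOn
  obtain ⟨huL, hu⟩ := mem_relatedIn.1 hu
  have h1 := hmem u huL
  have h2 := hmem v hv
  simp only [Finset.coe_filter, Finset.mem_univ, true_and, Set.mem_ofPred_eq]
  rcases hu with rfl | hu | hu
  · simp only [symmDiff_self, Finset.bot_eq_empty, Finset.card_empty]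
    omega
  · rw [symmDiff_of_le hu, Finset.card_sdiff_of_subset hu]
    omega
  · rw [symmDiff_of_ge hu, Finset.card_sdiff_of_subset hu]
    omega

end MiddleLayers

section Counting

lemma antichainCount_eq (n s : ℕ) : antichainCount n s =
    (antichainsIn (· ⊆ ·) (Finset.univ : Finset (Finset (Fin n))) s).card := by
  rw [antichainCount]
  congr 1
  ext S
  simp [mem_antichainsIn]

lemma eventually_choose_le_antichainCount {t : ℕ} (ht : 1 ≤ t) {s : ℕ → ℕ}
    (hhigh : Filter.Tendsto
      (fun n : ℕ => (s n : ℝ) * (n : ℝ) ^ (t - 1) / (n.choose (n / 2) : ℝ))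
      Filter.atTop (nhds 0)) {ε : ℝ} (hε : 0 < ε) :
    ∀ᶠ n : ℕ in Filter.atTop,
      Nat.choose ⌊((t : ℝ) - ε) * (n.choose (n / 2) : ℝ)⌋₊ (s n) ≤ antichainCount n (s n) := by
  have ht0 : (0 : ℝ) < t := by exact_mod_cast ht
  filter_upwards [eventually_le_card_middleLayers ht (half_pos hε),
    hhigh.eventually_le_const (by positivity : 0 < ε / 2 / t),
    Filter.eventually_ge_atTop 1] with n hL hs hn
  have hm : (0 : ℝ) < n.choose (n / 2) := by
    exact_mod_cast Nat.choose_pos (Nat.div_le_self n 2)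
  rw [div_le_iff₀ hm, div_mul_eq_mul_div, le_div_iff₀ ht0] at hs
  rw [antichainCount_eq]
  refine (choose_le_card_antichainsIn (r := (· ⊆ ·))
    (fun v hv => card_relatedIn_middleLayers_le hn t hv) (Nat.floor_le_of_le ?_)).trans
    (Finset.card_le_card fun S hS => ?_)
  · have h1 : ((middleLayers n t).card : ℝ) ≤
        ((middleLayers n t).card - s n * (t * n ^ (t - 1)) : ℕ) +
          s n * (t * (n : ℝ) ^ (t - 1)) := by
      exact_mod_cast Nat.sub_le_iff_le_add.1 le_rfl
    linarith
  · rw [mem_antichainsIn] at hS ⊢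
    exact ⟨⟨Finset.subset_univ _, hS.1.2⟩, hS.2⟩

lemma pow_mul_descFactorial_le {q : ℝ} (hq : 1 ≤ q) {R R' : ℕ} (h : q * R ≤ R') (s : ℕ) :
    q ^ s * (R.descFactorial s : ℝ) ≤ R'.descFactorial s := by
  induction s with
  | zero => simp
  | succ s ih =>
    rw [Nat.descFactorial_succ, Nat.descFactorial_succ, Nat.cast_mul, Nat.cast_mul]
    have h1 : q * ((R - s : ℕ) : ℝ) ≤ ((R' - s : ℕ) : ℝ) := by
      rcases le_total R s with hRs | hRs
      · rw [Nat.sub_eq_zero_of_le hRs]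
        simp
      · have : (R' : ℝ) ≤ ((R' - s : ℕ) : ℝ) + s := by
          exact_mod_cast Nat.sub_le_iff_le_add.1 le_rfl
        rw [Nat.cast_sub hRs]
        have : (s : ℝ) ≤ q * s := le_mul_of_one_le_left (by positivity) hq
        linarith
    calc q ^ (s + 1) * (((R - s : ℕ) : ℝ) * R.descFactorial s)
        = (q * ((R - s : ℕ) : ℝ)) * (q ^ s * R.descFactorial s) := by ring
      _ ≤ _ := mul_le_mul h1 ih (by positivity) (by positivity)

lemma pow_mul_choose_le {q : ℝ} (hq : 1 ≤ q) {R R' : ℕ} (h : q * R ≤ R') (s : ℕ) :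
    q ^ s * (R.choose s : ℝ) ≤ R'.choose s := by
  have h1 := pow_mul_descFactorial_le hq h s
  rw [Nat.descFactorial_eq_factorial_mul_choose, Nat.descFactorial_eq_factorial_mul_choose,
    Nat.cast_mul, Nat.cast_mul] at h1
  refine le_of_mul_le_mul_left ?_ (by exact_mod_cast s.factorial_pos : (0 : ℝ) < s.factorial)
  linarith

lemma choose_le_mul_choose_succ {R s S : ℕ} {m : ℝ} (hm : 0 < m) (hs : s < S)
    (hS : (S : ℝ) ≤ m / 2) (hR : m ≤ R) :
    (R.choose s : ℝ) ≤ 2 * S / m * R.choose (s + 1) := by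
  have hs' : (s : ℝ) + 1 ≤ S := by exact_mod_cast hs
  have hsR : s ≤ R := by
    have : (s : ℝ) ≤ R := by linarith
    exact_mod_cast this
  have hrec : (R.choose (s + 1) : ℝ) * (s + 1) = R.choose s * (R - s) := by
    have := Nat.choose_succ_right_eq R s
    rw [← Nat.cast_sub hsR]
    exact_mod_cast this
  have h0 : (0 : ℝ) ≤ R.choose s := by positivity
  have h1 : (0 : ℝ) ≤ R.choose (s + 1) := by positivity
  rw [div_mul_eq_mul_div, le_div_iff₀ hm]
  nlinarith [mul_le_mul_of_nonneg_left hs' h1,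
    mul_le_mul_of_nonneg_left (by linarith : m / 2 ≤ R - s) h0]

lemma le_mul_one_add_pow {y ρ : ℝ} {D : ℕ} (hy : 0 ≤ y) (h : ρ ≤ y ^ 2 * D) :
    ρ ≤ y * (1 + y) ^ D := by
  have h1 := one_add_mul_le_pow (by linarith : (-2 : ℝ) ≤ y) D
  calc ρ ≤ y * (D * y) := by linarith [h, (by ring : y ^ 2 * (D : ℝ) = y * (D * y))]
    _ ≤ y * (1 + y) ^ D := mul_le_mul_of_nonneg_left (by linarith) hy

lemma one_add_pow_le_exp {y b : ℝ} {k : ℕ} (hy : 0 ≤ y) (h : k * y ≤ b) :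
    (1 + y) ^ k ≤ Real.exp b := by
  calc (1 + y) ^ k ≤ Real.exp y ^ k := by
        gcongr
        linarith [Real.add_one_le_exp y]
    _ = Real.exp (k * y) := (Real.exp_nat_mul y k).symm
    _ ≤ Real.exp b := Real.exp_le_exp.2 h

/-- Two rounds of the Kleitman–Winston bound: first down to families of size `R₁`, then down to
families of size `R`. -/
lemma antichainCount_le_pow_mul_choose {n S R R₁ D₁ D₂ : ℕ} {ρ y₁ y₂ : ℝ} (hy₁ : 0 ≤ y₁)
    (hy₂ : 0 ≤ y₂)
    (hdeg₁ : ∀ A : Finset (Finset (Fin n)), R₁ < A.card →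
      ∃ v ∈ A, D₁ < (relatedIn (· ⊆ ·) A v).card)
    (hdeg₂ : ∀ A : Finset (Finset (Fin n)), R < A.card →
      ∃ v ∈ A, D₂ < (relatedIn (· ⊆ ·) A v).card)
    (hratio : ∀ k < S, (R.choose k : ℝ) ≤ ρ * R.choose (k + 1))
    (hρ₁ : ρ ≤ y₁ * (1 + y₁) ^ D₁) (hρ₂ : ρ ≤ y₂ * (1 + y₂) ^ D₂) :
    (antichainCount n S : ℝ) ≤ (1 + y₁) ^ 2 ^ n * ((1 + y₂) ^ R₁ * R.choose S) := by
  have hsmall : ∀ A : Finset (Finset (Fin n)), A.card ≤ R₁ → ∀ k ≤ S,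
      ((antichainsIn (· ⊆ ·) A k).card : ℝ) ≤ (1 + y₂) ^ R₁ * R.choose k := by
    intro A hA k hk
    refine (card_antichainsIn_le_pow_mul (g := fun k => (R.choose k : ℝ)) hy₂
      (fun _ => by positivity) hdeg₂ (fun B hB k _ => ?_) hratio hρ₂ A k hk).trans ?_
    · exact_mod_cast (card_antichainsIn_le_choose B k).trans (Nat.choose_le_choose k hB)
    · have : (1 + y₂) ^ A.card ≤ (1 + y₂) ^ R₁ := pow_le_pow_right₀ (by linarith) hA
      gcongr
  have hratio' : ∀ k < S, (1 + y₂) ^ R₁ * (R.choose k : ℝ) ≤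
      ρ * ((1 + y₂) ^ R₁ * (R.choose (k + 1) : ℝ)) := fun k hk => by
    have h1 := mul_le_mul_of_nonneg_left (hratio k hk)
      (by positivity : 0 ≤ (1 + y₂) ^ R₁)
    linarith
  have h := card_antichainsIn_le_pow_mul (α := Finset (Fin n))
    (g := fun k => (1 + y₂) ^ R₁ * (R.choose k : ℝ)) hy₁ (fun _ => by positivity) hdeg₁ hsmall
    hratio' hρ₁ Finset.univ S le_rfl
  rwa [← antichainCount_eq, Finset.card_univ, Fintype.card_finset, Fintype.card_fin] at h

lemma eventually_antichainCount_le_choose {t : ℕ} (ht : 1 ≤ t) {s : ℕ → ℕ}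
    (hlow : Filter.Tendsto
      (fun n : ℕ => (s n : ℝ) * (n : ℝ) ^ t / (n.choose (n / 2) : ℝ))
      Filter.atTop Filter.atTop)
    (hhigh : Filter.Tendsto
      (fun n : ℕ => (s n : ℝ) * (n : ℝ) ^ (t - 1) / (n.choose (n / 2) : ℝ))
      Filter.atTop (nhds 0)) {ε : ℝ} (hε : 0 < ε) :
    ∀ᶠ n : ℕ in Filter.atTop,
      antichainCount n (s n) ≤ Nat.choose ⌈((t : ℝ) + ε) * (n.choose (n / 2) : ℝ)⌉₊ (s n) := by
  have ht1 : (1 : ℝ) ≤ t := by exact_mod_cast ht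
  obtain ⟨δ₁, hδ₁, hsat₁⟩ :=
    exists_eventually_exists_lt_card_relatedIn (T := t + 2) (by omega) one_pos
  obtain ⟨δ₂, hδ₂, hsat₂⟩ := exists_eventually_exists_lt_card_relatedIn ht (half_pos hε)
  set q : ℝ := (t + ε) / (t + ε / 2) with hq
  have hq1 : 1 < q := by
    rw [hq, one_lt_div (by positivity)]
    linarith
  set c : ℝ := Real.log q / (t + 4) with hc
  have hc0 : 0 < c := div_pos (Real.log_pos hq1) (by positivity)
  filter_upwards [hsat₁, hsat₂, hlow.eventually_ge_atTop (8 / (c ^ 2 * δ₁)),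
    hlow.eventually_ge_atTop (2 / (c ^ 2 * δ₂)),
    hhigh.eventually_le_const (by norm_num : (0 : ℝ) < 1 / 2),
    Filter.eventually_ge_atTop 1] with n hn₁ hn₂ hω₁ hω₂ hs hn
  obtain ⟨D₁, hD₁, hdeg₁⟩ := hn₁
  obtain ⟨D₂, hD₂, hdeg₂⟩ := hn₂
  set M := n.choose (n / 2) with hM
  set m : ℝ := (M : ℝ) with hm
  have hm0 : 0 < m := by
    rw [hm, hM]
    exact_mod_cast Nat.choose_pos (Nat.div_le_self n 2)
  have hn1 : (1 : ℝ) ≤ n := by exact_mod_cast hn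
  set σ : ℝ := (s n : ℝ) with hσ
  have hσ0 : 0 ≤ σ := by positivity
  have hsm : σ ≤ m / 2 := by
    rw [div_le_iff₀ hm0] at hs
    have := le_mul_of_one_le_right hσ0 (one_le_pow₀ hn1 : (1 : ℝ) ≤ (n : ℝ) ^ (t - 1))
    linarith
  rw [div_le_div_iff₀ (by positivity) hm0] at hω₁ hω₂
  set R := ⌊((t : ℝ) + ε / 2) * m⌋₊ with hR
  have hmR : m ≤ R := by
    have h1 : M ≤ R := Nat.le_floor (by nlinarith)
    exact Nat.cast_le.2 h1
  have hratio : ∀ k < s n, (R.choose k : ℝ) ≤ 2 * σ / m * R.choose (k + 1) := fun k hk =>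
    choose_le_mul_choose_succ hm0 hk hsm hmR
  set y₁ : ℝ := c * σ / ((n + 1) * m) with hy₁
  set y₂ : ℝ := c * σ / m with hy₂
  have hy₁0 : 0 ≤ y₁ := by positivity
  have hy₂0 : 0 ≤ y₂ := by positivity
  have hρ₂ : 2 * σ / m ≤ y₂ * (1 + y₂) ^ D₂ := by
    refine le_mul_one_add_pow hy₂0 ?_
    calc 2 * σ / m = (2 * m) * (σ / m ^ 2) := by field_simp
      _ ≤ (σ * n ^ t * (c ^ 2 * δ₂)) * (σ / m ^ 2) := by gcongr
      _ = y₂ ^ 2 * (δ₂ * n ^ t) := by rw [hy₂]; field_simp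
      _ ≤ _ := by gcongr
  have hρ₁ : 2 * σ / m ≤ y₁ * (1 + y₁) ^ D₁ := by
    refine le_mul_one_add_pow hy₁0 ?_
    have h4 : ((n : ℝ) + 1) ^ 2 ≤ 4 * n ^ 2 := by nlinarith
    calc 2 * σ / m = (8 * m) * (n + 1) ^ 2 * (σ / (4 * (n + 1) ^ 2 * m ^ 2)) := by
          field_simp
          ring
      _ ≤ (σ * n ^ t * (c ^ 2 * δ₁)) * (4 * n ^ 2) * (σ / (4 * (n + 1) ^ 2 * m ^ 2)) := by
          gcongr
      _ = y₁ ^ 2 * (δ₁ * n ^ (t + 2)) := by rw [hy₁, pow_add]; field_simp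
      _ ≤ _ := by gcongr
  set R₁ := (t + 3) * M with hR₁
  have hcount := antichainCount_le_pow_mul_choose (R₁ := R₁) hy₁0 hy₂0
    (fun B hB => hdeg₁ B (by
      have h1 : (R₁ : ℝ) ≤ B.card := Nat.cast_le.2 hB.le
      rw [hR₁] at h1
      push_cast at h1 ⊢
      linarith))
    (fun B hB => hdeg₂ B (Nat.lt_of_floor_lt hB).le) hratio hρ₁ hρ₂
  have he₁ : (1 + y₁) ^ 2 ^ n ≤ Real.exp (c * σ) := by
    refine one_add_pow_le_exp hy₁0 ?_
    have h2 : ((2 ^ n : ℕ) : ℝ) ≤ (n + 1) * m := by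
      rw [hm, hM]
      exact_mod_cast two_pow_le_mul_choose_half n
    calc _ ≤ ((n + 1) * m) * y₁ := by gcongr
      _ = c * σ := by rw [hy₁]; field_simp
  have he₂ : (1 + y₂) ^ R₁ ≤ Real.exp ((t + 3) * (c * σ)) := by
    refine one_add_pow_le_exp hy₂0 (le_of_eq ?_)
    rw [hy₂, hR₁]
    push_cast
    rw [← hm]
    field_simp
  have hexp : Real.exp (c * σ) * Real.exp ((t + 3) * (c * σ)) = q ^ s n := by
    rw [← Real.exp_add]
    have : c * σ + (t + 3) * (c * σ) = s n * Real.log q := by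
      rw [hc, ← hσ]
      field_simp
      ring
    rw [this, Real.exp_nat_mul, Real.exp_log (by linarith)]
  have hqR : q * R ≤ (⌈((t : ℝ) + ε) * m⌉₊ : ℝ) := by
    have h1 : (R : ℝ) ≤ (t + ε / 2) * m := Nat.floor_le (by positivity)
    calc q * R ≤ q * ((t + ε / 2) * m) := by gcongr
      _ = (t + ε) * m := by rw [hq]; field_simp
      _ ≤ _ := Nat.le_ceil _
  have hfinal : (antichainCount n (s n) : ℝ) ≤
      (Nat.choose ⌈((t : ℝ) + ε) * m⌉₊ (s n) : ℝ) :=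
    calc (antichainCount n (s n) : ℝ)
        ≤ (1 + y₁) ^ 2 ^ n * ((1 + y₂) ^ R₁ * R.choose (s n)) := hcount
      _ ≤ Real.exp (c * σ) * (Real.exp ((t + 3) * (c * σ)) * R.choose (s n)) := by gcongr
      _ = q ^ s n * R.choose (s n) := by rw [← mul_assoc, hexp]
      _ ≤ _ := pow_mul_choose_le hq1.le hqR _
  exact_mod_cast hfinal

end Counting

/-- Proposition 3: fix `t ∈ ℕ` and suppose `m/n^t ≪ s ≪ m/n^(t-1)` where
`m = C(n, ⌊n/2⌋)`.  Then the number of antichains of size `s` in `P(n)` is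
`C((t + o(1)) m, s)`: for every `ε > 0` and all large `n` it lies between
`C(⌊(t-ε)m⌋, s)` and `C(⌈(t+ε)m⌉, s)`. -/
theorem antichain_counting (t : ℕ) (ht : 1 ≤ t) (s : ℕ → ℕ)
    (hlow : Filter.Tendsto
      (fun n : ℕ => (s n : ℝ) * (n : ℝ) ^ t / (n.choose (n / 2) : ℝ))
      Filter.atTop Filter.atTop)
    (hhigh : Filter.Tendsto
      (fun n : ℕ => (s n : ℝ) * (n : ℝ) ^ (t - 1) / (n.choose (n / 2) : ℝ))
      Filter.atTop (nhds 0)) :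
    ∀ ε : ℝ, 0 < ε →
      ∀ᶠ n : ℕ in Filter.atTop,
        Nat.choose ⌊((t : ℝ) - ε) * (n.choose (n / 2) : ℝ)⌋₊ (s n) ≤
            antichainCount n (s n) ∧
          antichainCount n (s n) ≤
            Nat.choose ⌈((t : ℝ) + ε) * (n.choose (n / 2) : ℝ)⌉₊ (s n) := by
  intro ε hε
  exact (eventually_choose_le_antichainCount ht hhigh hε).and
    (eventually_antichainCount_le_choose ht hlow hhigh hε)
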